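/- arXiv:1907.02141 — 5 statements merged into one kernel-verified Lean document; each statement's English description precedes it below -/
import Mathlib

section
/- Let 1 → N → G → K → 1 be an extension of finite groups and p a prime. Then m_p(G) ≤ m_p(N) + m_p(K). Equivalently, if G has an elementary abelian p-subgroup of order p^k, then there exist natural numbers a and b with a + b = k such that N has an elementary abelian p-subgroup of order p^a and K has an elementary abelian p-subgroup of order p^b. -/
/-- A subgroup `E` of a group is an elementary abelian `p`-subgroup if it is
commutative and every element `x ∈ E` satisfies `x ^ p = 1`. -/
def IsElemAbelian {G : Type*} [Group G] (p : ℕ) (E : Subgroup G) : Prop :=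
  (∀ x ∈ E, ∀ y ∈ E, x * y = y * x) ∧ ∀ x ∈ E, x ^ p = 1

theorem IsElemAbelian.map {G H : Type*} [Group G] [Group H] {p : ℕ} {E : Subgroup G}
    (hE : IsElemAbelian p E) (f : G →* H) : IsElemAbelian p (E.map f) := by
  constructor
  · rintro _ ⟨x, hx, rfl⟩ _ ⟨y, hy, rfl⟩
    rw [← map_mul, hE.1 x hx y hy, map_mul]
  · rintro _ ⟨x, hx, rfl⟩
    rw [← map_pow, hE.2 x hx, map_one]

theorem IsElemAbelian.subgroupOf {G : Type*} [Group G] {p : ℕ} {E : Subgroup G}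
    (hE : IsElemAbelian p E) (N : Subgroup G) : IsElemAbelian p (E.subgroupOf N) :=
  ⟨fun x hx y hy => Subtype.ext (hE.1 x hx y hy), fun x hx => Subtype.ext (hE.2 x hx)⟩

theorem Subgroup.card_subgroupOf_mul_card_map_mk' {G : Type*} [Group G]
    (N : Subgroup G) [N.Normal] (E : Subgroup G) :
    Nat.card (E.subgroupOf N) * Nat.card (E.map (QuotientGroup.mk' N)) = Nat.card E := by
  have h : Nat.card (E.subgroupOf N) = Nat.card (N.subgroupOf E) := by
    rw [← Subgroup.card_map_of_injective (K := E.subgroupOf N) N.subtype_injective,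
      ← Subgroup.card_map_of_injective (K := N.subgroupOf E) E.subtype_injective,
      Subgroup.subgroupOf_map_subtype, Subgroup.subgroupOf_map_subtype, inf_comm]
  rw [h, ← Subgroup.relIndex_ker, QuotientGroup.ker_mk']
  exact (N.subgroupOf E).card_mul_index

/-- `m_p(G) ≤ m_p(N) + m_p(G/N)`: if the finite group `G` has an elementary abelian
`p`-subgroup of order `p ^ k`, then there are `a + b = k` such that `N` has an
elementary abelian `p`-subgroup of order `p ^ a` and `G/N` has one of order `p ^ b`. -/
theorem stmt_4 {G : Type*} [Group G] [Fintype G] (p : ℕ) (hp : p.Prime)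
    (N : Subgroup G) [N.Normal] (k : ℕ)
    (E : Subgroup G) (hE : IsElemAbelian p E) (hcard : Nat.card E = p ^ k) :
    ∃ a b : ℕ, a + b = k ∧
      (∃ A : Subgroup N, IsElemAbelian p A ∧ Nat.card A = p ^ a) ∧
      (∃ B : Subgroup (G ⧸ N), IsElemAbelian p B ∧ Nat.card B = p ^ b) := by
  have h := N.card_subgroupOf_mul_card_map_mk' E
  rw [hcard] at h
  obtain ⟨a, -, ha⟩ := (Nat.dvd_prime_pow hp).1 (Dvd.intro _ h)
  obtain ⟨b, -, hb⟩ := (Nat.dvd_prime_pow hp).1 (Dvd.intro_left _ h)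
  refine ⟨a, b, ?_, ⟨_, hE.subgroupOf N, ha⟩, ⟨_, hE.map _, hb⟩⟩
  rw [ha, hb, ← pow_add] at h
  exact Nat.pow_right_injective hp.two_le h
end

section
/- Let G be a finite group, p a prime, H a subgroup of G, and E an elementary abelian p-subgroup of G with E ∩ H = 1. Then for every elementary abelian p-subgroup B of G with E ≤ B: (i) B ∩ H is contained in the centralizer of E in H; (ii) the subgroup generated by B ∩ H and E is an elementary abelian p-subgroup contained in B, of order |B ∩ H| · |E|; and (iii) the intersection of this subgroup with H equals B ∩ H. -/
theorem IsElemAbelian.mono {G : Type*} [Group G] {p : ℕ} {K L : Subgroup G}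
    (hL : IsElemAbelian p L) (hKL : K ≤ L) : IsElemAbelian p K :=
  ⟨fun x hx y hy => hL.1 x (hKL hx) y (hKL hy), fun x hx => hL.2 x (hKL hx)⟩

theorem Subgroup.card_sup_of_commute_of_disjoint {G : Type*} [Group G] {K L : Subgroup G}
    (h : ∀ x ∈ K, ∀ y ∈ L, Commute x y) (hKL : Disjoint K L) :
    Nat.card (K ⊔ L : Subgroup G) = Nat.card K * Nat.card L := by
  have comm : ∀ (x : K) (y : L), Commute (K.subtype x) (L.subtype y) :=
    fun x y => h x x.2 y y.2
  have hinj : Function.Injective (MonoidHom.noncommCoprod K.subtype L.subtype comm) := by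
    rw [MonoidHom.noncommCoprod_injective, range_subtype, range_subtype]
    exact ⟨K.subtype_injective, L.subtype_injective, hKL⟩
  have hrange : (MonoidHom.noncommCoprod K.subtype L.subtype comm).range = K ⊔ L := by
    rw [MonoidHom.noncommCoprod_range, range_subtype, range_subtype]
  rw [← Nat.card_prod, ← hrange]
  exact (Nat.card_congr (MonoidHom.ofInjective hinj).toEquiv).symm

/-- Combinatorial core of Lemma 4.2: for `H ≤ G`, `E` elementary abelian with
`E ∩ H = 1`, and any elementary abelian `B` containing `E`:
(i) `B ∩ H ≤ C_H(E)`; (ii) `(B ∩ H)E` is an elementary abelian `p`-subgroup contained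
in `B` of order `|B ∩ H| * |E|`; (iii) `((B ∩ H)E) ∩ H = B ∩ H`. -/
theorem stmt_6 {G : Type*} [Group G] [Fintype G] (p : ℕ) (hp : p.Prime)
    (H E : Subgroup G) (hE : IsElemAbelian p E) (hEH : E ⊓ H = ⊥)
    (B : Subgroup G) (hB : IsElemAbelian p B) (hEB : E ≤ B) :
    B ⊓ H ≤ H ⊓ Subgroup.centralizer (E : Set G) ∧
      IsElemAbelian p ((B ⊓ H) ⊔ E) ∧ (B ⊓ H) ⊔ E ≤ B ∧
      Nat.card ((B ⊓ H) ⊔ E : Subgroup G) =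
        Nat.card (B ⊓ H : Subgroup G) * Nat.card E ∧
      ((B ⊓ H) ⊔ E) ⊓ H = B ⊓ H := by
  have hcomm : ∀ x ∈ B ⊓ H, ∀ y ∈ E, Commute x y :=
    fun x hx y hy => hB.1 x hx.1 y (hEB hy)
  have hle : (B ⊓ H) ⊔ E ≤ B := sup_le inf_le_left hEB
  have hdisj : Disjoint (B ⊓ H) E :=
    (disjoint_iff.2 hEH).symm.mono_left inf_le_right
  refine ⟨fun x hx => ⟨hx.2, fun y hy => hB.1 y (hEB hy) x hx.1⟩, hB.mono hle, hle,
    Subgroup.card_sup_of_commute_of_disjoint hcomm hdisj, ?_⟩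
  exact le_antisymm (inf_le_inf_right H hle) (le_inf le_sup_left inf_le_right)
end

section
/- Let G be a finite group, p a prime, and L a normal subgroup of G of index p. Then in any strictly increasing chain Q₀ < Q₁ < ... < Qₙ of subgroups of G there is at most one index i (with 0 ≤ i < n) such that Qᵢ ∩ L = Q_{i+1} ∩ L. -/
namespace Subgroup

variable {G : Type*} [Group G] {L : Subgroup G}

theorem sup_eq_top_of_prime_index (hL : L.index.Prime) {A : Subgroup G} (hA : ¬A ≤ L) :
    A ⊔ L = ⊤ := by
  have h_mul : L.relIndex (A ⊔ L) * (A ⊔ L).index = L.index :=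
    relIndex_mul_index le_sup_right
  rcases (Nat.dvd_prime hL).1 (Dvd.intro_left _ h_mul) with h | h
  · exact index_eq_one.1 h
  · rw [h] at h_mul
    have h_rel : L.relIndex (A ⊔ L) = 1 := Nat.eq_of_mul_eq_mul_right hL.pos (by simpa using h_mul)
    exact absurd (le_sup_left.trans (relIndex_eq_one.1 h_rel)) hA

theorem not_le_of_lt_of_inf_eq {A B : Subgroup G} (hAB : A < B) (h : A ⊓ L = B ⊓ L) :
    ¬B ≤ L := fun hB =>
  hAB.ne (by rwa [inf_eq_left.2 hB, inf_eq_left.2 (hAB.le.trans hB)] at h)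

theorem le_of_lt_of_inf_eq [L.Normal] (hL : L.index.Prime) {A B : Subgroup G} (hAB : A < B)
    (h : A ⊓ L = B ⊓ L) : A ≤ L := by
  by_contra hA
  refine hAB.not_ge fun b hb => ?_
  have h_mem : b ∈ A ⊔ L := sup_eq_top_of_prime_index hL hA ▸ mem_top b
  obtain ⟨a, ha, l, hl, rfl⟩ := mem_sup_of_normal_right.1 h_mem
  have hlB : l ∈ B := (B.mul_mem_cancel_left (hAB.le ha)).1 hb
  have hlA : l ∈ A ⊓ L := h ▸ mem_inf.2 ⟨hlB, hl⟩
  exact A.mul_mem ha hlA.1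

end Subgroup

/-- If `L ⊴ G` has index the prime `p`, then in any strictly increasing chain
`Q₀ < Q₁ < ... < Qₙ` of subgroups of `G` there is at most one index `i` with
`Qᵢ ⊓ L = Q_{i+1} ⊓ L`. -/
theorem stmt_8 {G : Type*} [Group G] [Fintype G] (p : ℕ) (hp : p.Prime)
    (L : Subgroup G) (hL : L.Normal) (hidx : L.index = p)
    (n : ℕ) (Q : Fin (n + 1) → Subgroup G) (hQ : StrictMono Q) :
    ∀ i j : Fin n, Q i.castSucc ⊓ L = Q i.succ ⊓ L →
      Q j.castSucc ⊓ L = Q j.succ ⊓ L → i = j := by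
  have h_not_lt : ∀ i j : Fin n, Q i.castSucc ⊓ L = Q i.succ ⊓ L →
      Q j.castSucc ⊓ L = Q j.succ ⊓ L → ¬i < j := fun i j hi hj hij =>
    Subgroup.not_le_of_lt_of_inf_eq (hQ i.castSucc_lt_succ) hi
      ((hQ.monotone (Fin.succ_le_castSucc_iff.2 hij)).trans
        (Subgroup.le_of_lt_of_inf_eq (hidx ▸ hp) (hQ j.castSucc_lt_succ) hj))
  intro i j hi hj
  exact le_antisymm (not_lt.1 (h_not_lt j i hj hi)) (not_lt.1 (h_not_lt i j hi hj))
end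

section
/- Let p be a prime and let L₁ and L₂ be finite groups each having the trivial intersection property at p. Then every strictly increasing chain of nontrivial subgroups of L₁ × L₂, each of which is the intersection of a nonempty family of Sylow p-subgroups of L₁ × L₂, contains at most 2 subgroups. -/
/-- A finite group has the trivial intersection property at `p` if any two distinct
Sylow `p`-subgroups intersect trivially. -/
def TrivialIntersectionAt (p : ℕ) (L : Type*) [Group L] : Prop :=
  ∀ P Q : Sylow p L, P ≠ Q → (P : Subgroup L) ⊓ (Q : Subgroup L) = ⊥

/-- A Sylow subgroup of a direct product is the product of its projections. -/
theorem Sylow.coe_eq_prod_map {p : ℕ} {G H : Type*} [Group G] [Group H]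
    (P : Sylow p (G × H)) :
    (P : Subgroup (G × H)) =
      ((P : Subgroup (G × H)).map (MonoidHom.fst G H)).prod
        ((P : Subgroup (G × H)).map (MonoidHom.snd G H)) := by
  refine (P.is_maximal' ?_ ?_).symm
  · rintro ⟨⟨a, b⟩, ha, hb⟩
    obtain ⟨k, hk⟩ := P.isPGroup'.map (MonoidHom.fst G H) ⟨a, ha⟩
    obtain ⟨l, hl⟩ := P.isPGroup'.map (MonoidHom.snd G H) ⟨b, hb⟩
    have hk' : a ^ p ^ k = 1 := congrArg Subtype.val hk
    have hl' : b ^ p ^ l = 1 := congrArg Subtype.val hl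
    refine ⟨k + l, Subtype.ext (Prod.ext ?_ ?_)⟩
    · change a ^ p ^ (k + l) = 1
      rw [pow_add, pow_mul, hk', one_pow]
    · change b ^ p ^ (k + l) = 1
      rw [pow_add, mul_comm, pow_mul, hl', one_pow]
  · exact fun x hx => ⟨⟨x, hx, rfl⟩, ⟨x, hx, rfl⟩⟩

/-- In a group with the trivial intersection property, the intersection of a nonempty family of
Sylow subgroups is either trivial or a Sylow subgroup. -/
theorem TrivialIntersectionAt.biInf_eq_bot_or {p : ℕ} {L ι : Type*} [Group L]
    (h : TrivialIntersectionAt p L) {S : Set ι} (hS : S.Nonempty) (f : ι → Sylow p L) :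
    (⨅ i ∈ S, (f i : Subgroup L)) = ⊥ ∨ ∃ P : Sylow p L, (⨅ i ∈ S, (f i : Subgroup L)) = P := by
  obtain ⟨i, hi⟩ := hS
  by_cases hall : ∀ j ∈ S, f j = f i
  · right
    refine ⟨f i, le_antisymm (iInf₂_le i hi) (le_iInf₂ fun j hj => ?_)⟩
    rw [hall j hj]
  · left
    push Not at hall
    obtain ⟨j, hj, hne⟩ := hall
    rw [eq_bot_iff, ← h _ _ hne]
    exact le_inf (iInf₂_le j hj) (iInf₂_le i hi)

/-- If `A ≤ B` are subgroups each of which is trivial or Sylow and `A` is nontrivial,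
then `A = B`. -/
theorem Subgroup.eq_of_le_of_bot_or_sylow {p : ℕ} {L : Type*} [Group L] {A B : Subgroup L}
    (hA : A = ⊥ ∨ ∃ P : Sylow p L, A = P) (hB : B = ⊥ ∨ ∃ P : Sylow p L, B = P)
    (hAB : A ≤ B) (hne : A ≠ ⊥) : A = B := by
  obtain ⟨P, rfl⟩ := hA.resolve_left hne
  rcases hB with rfl | ⟨R, rfl⟩
  · exact absurd (le_bot_iff.mp hAB) hne
  · exact (P.is_maximal' R.isPGroup' hAB).symm

/-- An intersection of Sylow subgroups of a product of two groups with the trivial intersection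
property is a product of subgroups each of which is trivial or Sylow. -/
theorem TrivialIntersectionAt.exists_biInf_eq_prod {p : ℕ} [Fact p.Prime] {G H : Type*}
    [Group G] [Group H] [Finite G] [Finite H]
    (hG : TrivialIntersectionAt p G) (hH : TrivialIntersectionAt p H)
    {S : Set (Sylow p (G × H))} (hS : S.Nonempty) :
    ∃ (A : Subgroup G) (B : Subgroup H),
      (A = ⊥ ∨ ∃ P : Sylow p G, A = P) ∧ (B = ⊥ ∨ ∃ P : Sylow p H, B = P) ∧
      (⨅ P ∈ S, (P : Subgroup (G × H))) = A.prod B := by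
  have hfst : Function.Surjective (MonoidHom.fst G H) := Prod.fst_surjective
  have hsnd : Function.Surjective (MonoidHom.snd G H) := Prod.snd_surjective
  refine ⟨_, _, hG.biInf_eq_bot_or hS fun P => P.mapSurjective hfst,
    hH.biInf_eq_bot_or hS fun P => P.mapSurjective hsnd, ?_⟩
  ext x
  simp only [Subgroup.mem_iInf, Subgroup.mem_prod, Sylow.coe_mapSurjective, ← forall_and]
  refine forall₂_congr fun P _ => ?_
  conv_lhs => rw [P.coe_eq_prod_map]
  exact Subgroup.mem_prod

/-- If `L₁` and `L₂` are finite groups with the trivial intersection property at `p`,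
then every strictly increasing chain of nontrivial subgroups of `L₁ × L₂`, each an
intersection of a nonempty family of Sylow `p`-subgroups, has at most 2 members. -/
theorem stmt_10 {L₁ L₂ : Type*} [Group L₁] [Group L₂] [Fintype L₁] [Fintype L₂]
    (p : ℕ) (hp : p.Prime)
    (h1 : TrivialIntersectionAt p L₁) (h2 : TrivialIntersectionAt p L₂)
    (n : ℕ) (Q : Fin n → Subgroup (L₁ × L₂)) (hQ : StrictMono Q)
    (hne : ∀ i, Q i ≠ ⊥)
    (hint : ∀ i, ∃ S : Set (Sylow p (L₁ × L₂)), S.Nonempty ∧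
      Q i = ⨅ P ∈ S, (P : Subgroup (L₁ × L₂))) :
    n ≤ 2 := by
  have := Fact.mk hp
  have hprod (i : Fin n) : ∃ (A : Subgroup L₁) (B : Subgroup L₂),
      (A = ⊥ ∨ ∃ P : Sylow p L₁, A = P) ∧ (B = ⊥ ∨ ∃ P : Sylow p L₂, B = P) ∧
      Q i = A.prod B := by
    obtain ⟨S, hS, h⟩ := hint i
    rw [h]
    exact h1.exists_biInf_eq_prod h2 hS
  choose A B hA hB hAB using hprod
  have hle {i j : Fin n} (hij : i < j) : A i ≤ A j ∧ B i ≤ B j := by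
    have h := (hQ hij).le
    rw [hAB, hAB] at h
    exact ⟨fun a ha => (h (show (a, 1) ∈ (A i).prod (B i) from ⟨ha, one_mem _⟩)).1,
      fun b hb => (h (show (1, b) ∈ (A i).prod (B i) from ⟨one_mem _, hb⟩)).2⟩
  have heqA {i j : Fin n} (hij : i < j) : A i ≠ ⊥ → A i = A j :=
    Subgroup.eq_of_le_of_bot_or_sylow (hA i) (hA j) (hle hij).1
  have heqB {i j : Fin n} (hij : i < j) : B i ≠ ⊥ → B i = B j :=
    Subgroup.eq_of_le_of_bot_or_sylow (hB i) (hB j) (hle hij).2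
  have hlt {i j : Fin n} (hij : i < j) : ¬(A i = A j ∧ B i = B j) := fun h =>
    (hQ hij).ne (by rw [hAB, hAB, h.1, h.2])
  have hbot (i : Fin n) : ¬(A i = ⊥ ∧ B i = ⊥) := fun h =>
    hne i (by rw [hAB, h.1, h.2, Subgroup.bot_prod_bot])
  by_contra! hn
  have h01 : (⟨0, by omega⟩ : Fin n) < ⟨1, by omega⟩ := by simp
  have h12 : (⟨1, by omega⟩ : Fin n) < ⟨2, hn⟩ := by simp
  have hA01 := heqA h01
  have hB01 := heqB h01
  have hA12 := heqA h12
  have hB12 := heqB h12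
  have hlt01 := hlt h01
  have hlt12 := hlt h12
  have hbot0 := hbot ⟨0, by omega⟩
  grind
end

section
/- Let p be a prime, let L₁ and L₂ be finite groups each having the trivial intersection property at p, and let G be a finite group containing L = L₁ × L₂ as a normal subgroup of index p. Then every strictly increasing chain of nontrivial subgroups of G, each of which is the intersection of a nonempty family of Sylow p-subgroups of G, contains at most 3 subgroups. -/
open scoped Pointwise in
/-- The intersection of a Sylow `p`-subgroup of a finite group with a normal subgroup `N` is a
Sylow `p`-subgroup of `N`. -/
theorem Sylow.exists_coe_eq_subgroupOf_of_normal {G : Type*} [Group G] [Finite G] {p : ℕ}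
    [Fact p.Prime] (P : Sylow p G) (N : Subgroup G) [hN : N.Normal] :
    ∃ R : Sylow p N, (R : Subgroup N) = (P : Subgroup G).subgroupOf N := by
  refine ⟨⟨_, P.isPGroup'.comap_subtype, fun {T} hT hle => ?_⟩, rfl⟩
  obtain ⟨Q, hQ⟩ := (hT.map N.subtype).exists_le_sylow
  obtain ⟨g, rfl⟩ := MulAction.exists_smul_eq G P Q
  have hconj : ∀ t : T, g⁻¹ * ((t : N) : G) * g ∈ (P : Subgroup G) := fun t => by
    have ht : ((t : N) : G) ∈ (g • P : Sylow p G) := hQ ⟨t, t.2, rfl⟩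
    have ht' : ((t : N) : G) ∈ MulAut.conj g • (P : Subgroup G) := ht
    rw [Subgroup.mem_pointwise_smul_iff_inv_smul_mem] at ht'
    simpa [MulAut.smul_def, ← map_inv] using ht'
  let f : T → (P : Subgroup G).subgroupOf N := fun t =>
    ⟨⟨g⁻¹ * ((t : N) : G) * g, by simpa using hN.conj_mem _ (t : N).2 g⁻¹⟩, hconj t⟩
  have hf : Function.Injective f := fun s t hst => by
    have h : g⁻¹ * ((s : N) : G) * g = g⁻¹ * ((t : N) : G) * g :=
      congrArg Subtype.val (congrArg Subtype.val hst)
    exact Subtype.ext (Subtype.ext (mul_left_cancel (mul_right_cancel h)))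
  exact (Subgroup.eq_of_le_of_card_ge hle (Nat.card_le_card_of_injective f hf)).symm

theorem IsPGroup.subgroup_prod {A B : Type*} [Group A] [Group B] {p : ℕ}
    {H : Subgroup A} {K : Subgroup B} (hH : IsPGroup p H) (hK : IsPGroup p K) :
    IsPGroup p (H.prod K) := by
  rintro ⟨⟨a, b⟩, ha, hb⟩
  obtain ⟨k, hk⟩ := hH ⟨a, ha⟩
  obtain ⟨l, hl⟩ := hK ⟨b, hb⟩
  have hk' : a ^ p ^ k = 1 := congrArg Subtype.val hk
  have hl' : b ^ p ^ l = 1 := congrArg Subtype.val hl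
  refine ⟨k + l, Subtype.ext (Prod.ext ?_ ?_)⟩
  · change a ^ p ^ (k + l) = 1
    rw [pow_add, pow_mul, hk', one_pow]
  · change b ^ p ^ (k + l) = 1
    rw [pow_add, mul_comm, pow_mul, hl', one_pow]

theorem Subgroup.le_map_fst_prod_map_snd {A B : Type*} [Group A] [Group B]
    (R : Subgroup (A × B)) :
    R ≤ (R.map (MonoidHom.fst A B)).prod (R.map (MonoidHom.snd A B)) :=
  fun x hx => ⟨⟨x, hx, rfl⟩, ⟨x, hx, rfl⟩⟩

theorem Sylow.map_fst_prod_map_snd {A B : Type*} [Group A] [Group B] {p : ℕ}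
    (R : Sylow p (A × B)) :
    ((R : Subgroup (A × B)).map (MonoidHom.fst A B)).prod
      ((R : Subgroup (A × B)).map (MonoidHom.snd A B)) = R :=
  R.is_maximal' ((R.isPGroup'.map _).subgroup_prod (R.isPGroup'.map _))
    (Subgroup.le_map_fst_prod_map_snd _)

theorem Sylow.mk_mem_iff {A B : Type*} [Group A] [Group B] {p : ℕ} (R : Sylow p (A × B))
    (a : A) (b : B) : (a, b) ∈ (R : Subgroup (A × B)) ↔
      (a, 1) ∈ (R : Subgroup (A × B)) ∧ (1, b) ∈ (R : Subgroup (A × B)) := by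
  rw [← R.map_fst_prod_map_snd]
  simp only [Subgroup.mem_prod]
  exact ⟨fun h => ⟨⟨h.1, one_mem _⟩, one_mem _, h.2⟩, fun h => ⟨h.1.1, h.2.2⟩⟩

theorem Sylow.exists_coe_eq_comap_inl {A B : Type*} [Group A] [Group B] {p : ℕ}
    (R : Sylow p (A × B)) :
    ∃ S : Sylow p A, (S : Subgroup A) = (R : Subgroup (A × B)).comap (MonoidHom.inl A B) := by
  refine ⟨⟨_, R.isPGroup'.comap_of_injective _ fun _ _ h => congrArg Prod.fst h,
    fun {T} hT hle => le_antisymm (fun t ht => ?_) hle⟩, rfl⟩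
  have hR : (R : Subgroup (A × B)) ≤
      T.prod ((R : Subgroup (A × B)).map (MonoidHom.snd A B)) := by
    rintro ⟨a, b⟩ hab
    exact ⟨hle ((R.mk_mem_iff a b).1 hab).1, ⟨_, hab, rfl⟩⟩
  have := R.is_maximal' (hT.subgroup_prod (R.isPGroup'.map _)) hR
  change (t, 1) ∈ (R : Subgroup (A × B))
  rw [← this]
  exact ⟨ht, one_mem _⟩

theorem Sylow.exists_coe_eq_comap_inr {A B : Type*} [Group A] [Group B] {p : ℕ}
    (R : Sylow p (A × B)) :
    ∃ S : Sylow p B, (S : Subgroup B) = (R : Subgroup (A × B)).comap (MonoidHom.inr A B) := by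
  obtain ⟨S, hS⟩ := (R.comapOfInjective (MulEquiv.prodComm : B × A ≃* A × B).toMonoidHom
    (MulEquiv.injective _) fun x _ => MulEquiv.surjective _ x).exists_coe_eq_comap_inl
  exact ⟨S, hS⟩

/-- If preimages of Sylow subgroups under `φ` are Sylow subgroups of a trivial intersection
group, then the preimage of an intersection of Sylow subgroups is either trivial or
determined by the preimage of any larger such intersection. -/
theorem TrivialIntersectionAt.comap_eq_bot_or_eq {G H : Type*} [Group G] [Group H] {p : ℕ}
    (hH : TrivialIntersectionAt p H) (φ : H →* G)
    (hφ : ∀ P : Sylow p G, ∃ R : Sylow p H, (R : Subgroup H) = (P : Subgroup G).comap φ)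
    {X Y : Subgroup G} (hXY : X ≤ Y)
    (hX : ∃ S : Set (Sylow p G), S.Nonempty ∧ X = ⨅ P ∈ S, (P : Subgroup G))
    (hY : ∃ S : Set (Sylow p G), S.Nonempty ∧ Y = ⨅ P ∈ S, (P : Subgroup G)) :
    X.comap φ = ⊥ ∨ X.comap φ = Y.comap φ := by
  obtain ⟨S, -, hS⟩ := hX
  obtain ⟨T, ⟨P₀, hP₀⟩, hT⟩ := hY
  refine or_iff_not_imp_left.2 fun hne => le_antisymm (Subgroup.comap_mono hXY) ?_
  have hY₀ : Y ≤ P₀ := hT ▸ iInf₂_le P₀ hP₀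
  have hle : Y.comap φ ≤ (P₀ : Subgroup G).comap φ := Subgroup.comap_mono hY₀
  have key : ∀ P ∈ S, (P₀ : Subgroup G).comap φ ≤ (P : Subgroup G).comap φ := fun P hP => by
    obtain ⟨R₀, hR₀⟩ := hφ P₀
    obtain ⟨R, hR⟩ := hφ P
    have hXP : X ≤ P := hS ▸ iInf₂_le P hP
    by_cases h : R₀ = R
    · rw [← hR₀, ← hR, h]
    · refine absurd (le_bot_iff.1 ?_) hne
      rw [← hH R₀ R h, hR₀, hR]
      exact le_inf (Subgroup.comap_mono (hXY.trans hY₀)) (Subgroup.comap_mono hXP)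
  intro u hu
  change φ u ∈ X
  rw [hS]
  simp only [Subgroup.mem_iInf]
  exact fun P hP => key P hP (hle hu)

open scoped Classical in
theorem ite_eq_bot_le_and_eq {α : Type*} [PartialOrder α] [OrderBot α] {x y : α}
    (h : x = ⊥ ∨ x = y) :
    (if x = ⊥ then 0 else 1) ≤ (if y = ⊥ then 0 else 1) ∧
      ((if x = ⊥ then 0 else 1) = (if y = ⊥ then 0 else 1) → x = y) := by
  rcases h with rfl | rfl
  · by_cases hy : y = ⊥ <;> simp [hy]
  · simp

/-- If `G` contains `L ≅ L₁ × L₂` as a normal subgroup of index the prime `p`, where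
`L₁, L₂` have the trivial intersection property at `p`, then every strictly
increasing chain of nontrivial subgroups of `G`, each an intersection of a nonempty
family of Sylow `p`-subgroups of `G`, has at most 3 members. -/
theorem stmt_12 {G L₁ L₂ : Type*} [Group G] [Fintype G] [Group L₁] [Group L₂]
    (p : ℕ) (hp : p.Prime)
    (h1 : TrivialIntersectionAt p L₁) (h2 : TrivialIntersectionAt p L₂)
    (L : Subgroup G) (hL : L.Normal) (hidx : L.index = p)
    (e : L ≃* L₁ × L₂)
    (n : ℕ) (Q : Fin n → Subgroup G) (hQ : StrictMono Q)
    (hne : ∀ i, Q i ≠ ⊥)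
    (hint : ∀ i, ∃ S : Set (Sylow p G), S.Nonempty ∧
      Q i = ⨅ P ∈ S, (P : Subgroup G)) :
    n ≤ 3 := by
  classical
  have : Fact p.Prime := ⟨hp⟩
  let ψ : L₁ × L₂ →* G := L.subtype.comp e.symm.toMonoidHom
  let φ₁ : L₁ →* G := ψ.comp (MonoidHom.inl L₁ L₂)
  let φ₂ : L₂ →* G := ψ.comp (MonoidHom.inr L₁ L₂)
  have hψ : ∀ P : Sylow p G, ∃ R : Sylow p (L₁ × L₂),
      (R : Subgroup (L₁ × L₂)) = (P : Subgroup G).comap ψ := fun P => by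
    obtain ⟨R, hR⟩ := P.exists_coe_eq_subgroupOf_of_normal L
    refine ⟨R.comapOfInjective e.symm.toMonoidHom e.symm.injective
      fun x _ => e.symm.surjective x, ?_⟩
    exact (Sylow.coe_comapOfInjective _ _ _ _).trans (congrArg _ hR)
  have hφ₁ : ∀ P : Sylow p G, ∃ R : Sylow p L₁, (R : Subgroup L₁) = (P : Subgroup G).comap φ₁ :=
    fun P => by
      obtain ⟨R, hR⟩ := hψ P
      obtain ⟨S, hS⟩ := R.exists_coe_eq_comap_inl
      exact ⟨S, by rw [hS, hR]; rfl⟩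
  have hφ₂ : ∀ P : Sylow p G, ∃ R : Sylow p L₂, (R : Subgroup L₂) = (P : Subgroup G).comap φ₂ :=
    fun P => by
      obtain ⟨R, hR⟩ := hψ P
      obtain ⟨S, hS⟩ := R.exists_coe_eq_comap_inr
      exact ⟨S, by rw [hS, hR]; rfl⟩
  have hmem : ∀ i a b, ψ (a, b) ∈ Q i ↔ φ₁ a ∈ Q i ∧ φ₂ b ∈ Q i := fun i a b => by
    obtain ⟨S, -, hS⟩ := hint i
    have hP : ∀ P : Sylow p G, ψ (a, b) ∈ (P : Subgroup G) ↔
        φ₁ a ∈ (P : Subgroup G) ∧ φ₂ b ∈ (P : Subgroup G) := fun P => by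
      obtain ⟨R, hR⟩ := hψ P
      have := R.mk_mem_iff a b
      rw [hR] at this
      exact this
    simp only [hS, Subgroup.mem_iInf, hP]
    exact ⟨fun h => ⟨fun P hP => (h P hP).1, fun P hP => (h P hP).2⟩,
      fun h P hP => ⟨h.1 P hP, h.2 P hP⟩⟩
  have hLe : ∀ x : L, ψ (e x) = x := fun x => by simp [ψ]
  have hinter : ∀ i j, (Q i).comap φ₁ = (Q j).comap φ₁ → (Q i).comap φ₂ = (Q j).comap φ₂ →
      ∀ x ∈ L, x ∈ Q i ↔ x ∈ Q j := fun i j hij₁ hij₂ x hx => by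
    have h₁ := SetLike.ext_iff.1 hij₁ (e ⟨x, hx⟩).1
    have h₂ := SetLike.ext_iff.1 hij₂ (e ⟨x, hx⟩).2
    have hi := hmem i (e ⟨x, hx⟩).1 (e ⟨x, hx⟩).2
    have hj := hmem j (e ⟨x, hx⟩).1 (e ⟨x, hx⟩).2
    simp only [Prod.mk.eta, hLe] at hi hj
    simp only [Subgroup.mem_comap] at h₁ h₂
    rw [hi, hj, h₁, h₂]
  have hcard : (Nat.card (G ⧸ L)).Prime := by
    rw [← Subgroup.index_eq_card, hidx]; exact hp
  have : Fact (Nat.card (G ⧸ L)).Prime := ⟨hcard⟩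
  let r : Fin n → ℕ := fun i =>
    (if (Q i).comap φ₁ = ⊥ then 0 else 1) + (if (Q i).comap φ₂ = ⊥ then 0 else 1) +
      (if Q i ≤ L then 0 else 1)
  have hr : StrictMono r := fun i j hij => by
    have hlt := hQ hij
    have c₁ := h1.comap_eq_bot_or_eq φ₁ hφ₁ hlt.le (hint i) (hint j)
    have c₂ := h2.comap_eq_bot_or_eq φ₂ hφ₂ hlt.le (hint i) (hint j)
    have c₃ : Q j ≤ L → Q i ≤ L := hlt.le.trans
    have t₁ := ite_eq_bot_le_and_eq c₁
    have t₂ := ite_eq_bot_le_and_eq c₂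
    have t₃ : (if Q i ≤ L then 0 else 1) ≤ (if Q j ≤ L then 0 else 1) ∧
        ((if Q i ≤ L then 0 else 1) = (if Q j ≤ L then 0 else 1) → (Q i ≤ L ↔ Q j ≤ L)) := by
      split_ifs <;> simp_all
    have key : ¬ ((Q i).comap φ₁ = (Q j).comap φ₁ ∧ (Q i).comap φ₂ = (Q j).comap φ₂ ∧
        (Q i ≤ L ↔ Q j ≤ L)) := by
      rintro ⟨k₁, k₂, k₃⟩
      have hcap := hinter i j k₁ k₂
      refine hlt.not_ge fun y hy => ?_
      by_cases hjL : Q j ≤ L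
      · exact (hcap y (hjL hy)).2 hy
      · have htop : (Q i).map (QuotientGroup.mk' L) = ⊤ :=
          ((Q i).map (QuotientGroup.mk' L)).eq_bot_or_eq_top_of_prime_card.resolve_left
            fun h => hjL (k₃.1 (by
              rwa [Subgroup.map_eq_bot_iff, QuotientGroup.ker_mk'] at h))
        obtain ⟨x, hx, hxy⟩ : (y : G ⧸ L) ∈ (Q i).map (QuotientGroup.mk' L) :=
          htop ▸ Subgroup.mem_top _
        have hxyL : x⁻¹ * y ∈ L := QuotientGroup.eq.1 hxy
        have := (hcap _ hxyL).2 (mul_mem (inv_mem (hlt.le hx)) hy)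
        simpa using mul_mem hx this
    by_contra hcon
    change ¬ (_ + _ + _ < _ + _ + _) at hcon
    exact key ⟨t₁.2 (by omega), t₂.2 (by omega), t₃.2 (by omega)⟩
  have hpos : ∀ i, r i ∈ Finset.Icc 1 3 := fun i => by
    have key : ¬ ((Q i).comap φ₁ = ⊥ ∧ (Q i).comap φ₂ = ⊥ ∧ Q i ≤ L) := by
      rintro ⟨k₁, k₂, k₃⟩
      refine hne i ((Subgroup.eq_bot_iff_forall _).2 fun x hx => ?_)
      have hi := (hmem i (e ⟨x, k₃ hx⟩).1 (e ⟨x, k₃ hx⟩).2).1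
        (by simpa only [Prod.mk.eta, hLe] using hx)
      have a₁ : (e ⟨x, k₃ hx⟩).1 = 1 := (Subgroup.eq_bot_iff_forall _).1 k₁ _ hi.1
      have a₂ : (e ⟨x, k₃ hx⟩).2 = 1 := (Subgroup.eq_bot_iff_forall _).1 k₂ _ hi.2
      have a : e ⟨x, k₃ hx⟩ = 1 := Prod.ext a₁ a₂
      simpa using a
    rw [Finset.mem_Icc]
    clear_value φ₁ φ₂
    simp only [r]
    split_ifs <;> first | omega | exact absurd ⟨‹_›, ‹_›, ‹_›⟩ key
  simpa using Finset.card_le_card_of_injOn r (s := Finset.univ) (fun i _ => hpos i)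
    hr.injective.injOn
end
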